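/- Let R be a reduced graph and let B be an induced cycle of R of even length at least 8. Then no odd induced cycle of R has a vertex in common with B. -/

import Mathlib

/-! Common definitions: arc/interval representations, graph classes,
induced subgraph containment, small named graphs, reduced graphs. -/

/-- The point of the unit circle corresponding to parameter `t`. -/
noncomputable def circlePt (t : ℝ) : ℝ × ℝ :=
  (Real.cos (2 * Real.pi * t), Real.sin (2 * Real.pi * t))

/-- A (nonempty closed) arc of the unit circle: the image under
`t ↦ (cos 2πt, sin 2πt)` of a closed interval `[a, b] ⊆ ℝ` with `0 ≤ b - a < 1`. -/
def IsUnitCircleArc (A : Set (ℝ × ℝ)) : Prop :=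
  ∃ a b : ℝ, 0 ≤ b - a ∧ b - a < 1 ∧ A = circlePt '' Set.Icc a b

/-- An arc representation of a graph: each vertex gets an arc of the unit circle,
and two distinct vertices are adjacent iff their arcs intersect. -/
def IsArcRep {V : Type*} (G : SimpleGraph V) (f : V → Set (ℝ × ℝ)) : Prop :=
  (∀ v, IsUnitCircleArc (f v)) ∧
    ∀ u v : V, u ≠ v → (G.Adj u v ↔ (f u ∩ f v).Nonempty)

/-- A family of sets is proper if no member is properly contained in another. -/
def ProperFamily {V α : Type*} (f : V → Set α) : Prop :=
  ∀ u v : V, ¬ f u ⊂ f v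

/-- A family of sets is Helly if every subfamily of pairwise intersecting sets
has a common point. -/
def HellyFamily {V α : Type*} (f : V → Set α) : Prop :=
  ∀ S : Set V, (∀ u ∈ S, ∀ v ∈ S, (f u ∩ f v).Nonempty) → (⋂ v ∈ S, f v).Nonempty

/-- A proper circular-arc graph: admits an arc representation with no arc
properly contained in another. -/
def IsProperCircularArcGraph {V : Type*} (G : SimpleGraph V) : Prop :=
  ∃ f : V → Set (ℝ × ℝ), IsArcRep G f ∧ ProperFamily f

/-- A proper Helly circular-arc graph: admits an arc representation that is
simultaneously proper and Helly. -/
def IsProperHellyCircularArcGraph {V : Type*} (G : SimpleGraph V) : Prop :=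
  ∃ f : V → Set (ℝ × ℝ), IsArcRep G f ∧ ProperFamily f ∧ HellyFamily f

/-- An interval representation: each vertex gets a nonempty closed bounded
interval of ℝ; distinct vertices adjacent iff intervals intersect. -/
def IsIntervalRep {V : Type*} (G : SimpleGraph V) (f : V → Set ℝ) : Prop :=
  (∀ v, ∃ a b : ℝ, a ≤ b ∧ f v = Set.Icc a b) ∧
    ∀ u v : V, u ≠ v → (G.Adj u v ↔ (f u ∩ f v).Nonempty)

def IsIntervalGraph {V : Type*} (G : SimpleGraph V) : Prop :=
  ∃ f : V → Set ℝ, IsIntervalRep G f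

def IsProperIntervalGraph {V : Type*} (G : SimpleGraph V) : Prop :=
  ∃ f : V → Set ℝ, IsIntervalRep G f ∧ ProperFamily f

/-- A graph is bipartite: its vertices can be partitioned into two independent sets. -/
def IsBipartite {V : Type*} (G : SimpleGraph V) : Prop :=
  ∃ c : V → Bool, ∀ u v : V, G.Adj u v → c u ≠ c v

/-- A permutation graph. -/
def IsPermutationGraph {V : Type*} (G : SimpleGraph V) : Prop :=
  ∃ a b : V → ℝ, Function.Injective a ∧ Function.Injective b ∧
    ∀ u v : V, u ≠ v → (G.Adj u v ↔ (a u - a v) * (b u - b v) < 0)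

def IsBipartitePermutationGraph {V : Type*} (G : SimpleGraph V) : Prop :=
  IsPermutationGraph G ∧ IsBipartite G

/-- `f : ZMod ℓ → V` is an induced (chordless) cycle of length `ℓ ≥ 3` in `G`:
`f` is injective and two images are adjacent iff their indices are consecutive mod `ℓ`. -/
def IsInducedCycle {V : Type*} (G : SimpleGraph V) (ℓ : ℕ) (f : ZMod ℓ → V) : Prop :=
  3 ≤ ℓ ∧ Function.Injective f ∧
    ∀ i j : ZMod ℓ, G.Adj (f i) (f j) ↔ (i = j + 1 ∨ j = i + 1)

/-- `G` contains `H` as an induced subgraph. -/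
def ContainsInduced {V W : Type*} (G : SimpleGraph V) (H : SimpleGraph W) : Prop :=
  ∃ f : W → V, Function.Injective f ∧ ∀ u v : W, H.Adj u v ↔ G.Adj (f u) (f v)

/-- `G` contains `C_ℓ*`: an induced cycle of length `ℓ` together with a vertex
adjacent to no vertex of the cycle. -/
def HasCycleStar {V : Type*} (G : SimpleGraph V) (ℓ : ℕ) : Prop :=
  ∃ (f : ZMod ℓ → V) (v : V), IsInducedCycle G ℓ f ∧ ∀ i : ZMod ℓ, ¬ G.Adj v (f i)

/-- A maximal clique. -/
def IsMaxClique {V : Type*} (G : SimpleGraph V) (s : Set V) : Prop :=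
  G.IsClique s ∧ ∀ t : Set V, G.IsClique t → s ⊆ t → t = s

/-- A clique path: a linear arrangement of all maximal cliques of `G` such that
the cliques containing any fixed vertex are consecutive. -/
def IsCliquePath {W : Type*} (G : SimpleGraph W) (q : ℕ) (K : Fin q → Set W) : Prop :=
  Function.Injective K ∧ (∀ i, IsMaxClique G (K i)) ∧
    (∀ s : Set W, IsMaxClique G s → ∃ i, K i = s) ∧
    ∀ (v : W) (i j k : Fin q), i ≤ j → j ≤ k → v ∈ K i → v ∈ K k → v ∈ K j

/-- A circular interval of residues mod `n`: `{p, p+1, …, p+m}`. -/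
def IsCircInterval {n : ℕ} (s : Set (ZMod n)) : Prop :=
  ∃ (p : ZMod n) (m : ℕ), s = {x : ZMod n | ∃ k : ℕ, k ≤ m ∧ x = p + (k : ZMod n)}

/-! ### Small named graphs -/

/-- The claw `K_{1,3}`. -/
def clawG : SimpleGraph (Fin 4) := SimpleGraph.fromRel (fun u _ => u = 0)

/-- The net: a triangle `{0,1,2}` with pendant vertices `3,4,5` attached to
`0,1,2` respectively. -/
def netG : SimpleGraph (Fin 6) :=
  SimpleGraph.fromRel (fun u v => (u.val < 3 ∧ v.val < 3) ∨ v.val = u.val + 3)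

/-- The tent `S_3`: triangle `{0,1,2}`, independent set `{3,4,5}`, with
`3 ~ 0,1`, `4 ~ 1,2`, `5 ~ 2,0`. -/
def tentS3 : SimpleGraph (Fin 6) :=
  SimpleGraph.fromRel (fun u v =>
    (u.val < 3 ∧ v.val < 3) ∨ (u = 3 ∧ (v = 0 ∨ v = 1)) ∨
      (u = 4 ∧ (v = 1 ∨ v = 2)) ∨ (u = 5 ∧ (v = 2 ∨ v = 0)))

/-- `S_3*`: the tent together with an isolated vertex `6`. -/
def S3star : SimpleGraph (Fin 7) :=
  SimpleGraph.fromRel (fun u v =>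
    (u.val < 3 ∧ v.val < 3) ∨ (u = 3 ∧ (v = 0 ∨ v = 1)) ∨
      (u = 4 ∧ (v = 1 ∨ v = 2)) ∨ (u = 5 ∧ (v = 2 ∨ v = 0)))

/-- The complement of `S_3*`. -/
def compS3star : SimpleGraph (Fin 7) := S3starᶜ

/-- The complement of `C_4*`: two edges `0-2`, `1-3` plus a universal vertex `4`. -/
def compC4star : SimpleGraph (Fin 5) :=
  SimpleGraph.fromRel (fun u v => (u = 0 ∧ v = 2) ∨ (u = 1 ∧ v = 3) ∨ u = 4)

/-- The chordless cycle `C_6`. -/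
def cycle6G : SimpleGraph (Fin 6) :=
  SimpleGraph.fromRel (fun u v => v.val = (u.val + 1) % 6)

/-- The complement of `C_6`. -/
def compC6 : SimpleGraph (Fin 6) := cycle6Gᶜ

/-- The wheel `W_4`: a `C_4` on `{0,1,2,3}` plus a hub `4`. -/
def W4G : SimpleGraph (Fin 5) :=
  SimpleGraph.fromRel (fun u v => (u.val < 4 ∧ v.val = (u.val + 1) % 4) ∨ v = 4)

/-- The wheel `W_5`: a `C_5` on `{0,…,4}` plus a hub `5`. -/
def W5G : SimpleGraph (Fin 6) :=
  SimpleGraph.fromRel (fun u v => (u.val < 5 ∧ v.val = (u.val + 1) % 5) ∨ v = 5)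

/-- `F_1` (the long claw): the claw with each edge subdivided once. -/
def F1G : SimpleGraph (Fin 7) :=
  SimpleGraph.fromRel (fun u v =>
    (u = 0 ∧ v = 1) ∨ (u = 1 ∧ v = 2) ∨ (u = 0 ∧ v = 3) ∨ (u = 3 ∧ v = 4) ∨
      (u = 0 ∧ v = 5) ∨ (u = 5 ∧ v = 6))

/-- `F_2`: a `C_4` `0-1-2-3-0` with pendant vertices `4,5,6` attached to `0,2,3`. -/
def F2G : SimpleGraph (Fin 7) :=
  SimpleGraph.fromRel (fun u v =>
    (u = 0 ∧ v = 1) ∨ (u = 1 ∧ v = 2) ∨ (u = 2 ∧ v = 3) ∨ (u = 3 ∧ v = 0) ∨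
      (u = 0 ∧ v = 4) ∨ (u = 2 ∧ v = 5) ∨ (u = 3 ∧ v = 6))

/-- `F_3`: a `C_6` `0-1-2-3-4-5-0` with chord `0-3` and pendant `6` at `0`. -/
def F3G : SimpleGraph (Fin 7) :=
  SimpleGraph.fromRel (fun u v =>
    (u.val < 6 ∧ v.val = (u.val + 1) % 6) ∨ (u = 0 ∧ v = 3) ∨ (u = 0 ∧ v = 6))

/-- `F_4`: a `C_6` `0-1-2-3-4-5-0` with chord `0-3` and a vertex `6` adjacent
exactly to `0` and `3`. -/
def F4G : SimpleGraph (Fin 7) :=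
  SimpleGraph.fromRel (fun u v =>
    (u.val < 6 ∧ v.val = (u.val + 1) % 6) ∨ (u = 0 ∧ v = 3) ∨ (u = 6 ∧ (v = 0 ∨ v = 3)))

/-- A reduced graph: connected, co-connected, and containing none of
`C_3*`, `C_5*`, the complement of `C_4*`, `C_6`, `S_3`, the complement of `S_3*`,
`F_1`, `F_2`, `F_3`, `F_4` as induced subgraphs. -/
def IsReducedGraph {V : Type*} (R : SimpleGraph V) : Prop :=
  R.Connected ∧ Rᶜ.Connected ∧
    ¬ HasCycleStar R 3 ∧ ¬ HasCycleStar R 5 ∧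
    ¬ ContainsInduced R compC4star ∧
    ¬ (∃ f : ZMod 6 → V, IsInducedCycle R 6 f) ∧
    ¬ ContainsInduced R tentS3 ∧
    ¬ ContainsInduced R compS3star ∧
    ¬ ContainsInduced R F1G ∧ ¬ ContainsInduced R F2G ∧
    ¬ ContainsInduced R F3G ∧ ¬ ContainsInduced R F4G

section EvenHole

variable {V : Type*} {R : SimpleGraph V}

/-- A twin-free graph is contained in `R` as soon as some map of its vertices respects adjacency
and non-adjacency. -/
lemma containsInduced_of_twinFree {n : ℕ} {H : SimpleGraph (Fin n)} (f : Fin n → V)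
    (twin : ∀ i j, (∀ k, H.Adj i k ↔ H.Adj j k) → i = j)
    (h : ∀ i j, i < j → (H.Adj i j ↔ R.Adj (f i) (f j))) : ContainsInduced R H := by
  have key : ∀ i j, H.Adj i j ↔ R.Adj (f i) (f j) := by
    intro i j
    rcases lt_trichotomy i j with hij | rfl | hij
    · exact h i j hij
    · simp
    · rw [H.adj_comm, R.adj_comm]
      exact h j i hij
  refine ⟨f, fun i j hij => twin i j fun k => ?_, key⟩
  rw [key, key, hij]

instance : DecidableRel F1G.Adj := by
  unfold F1G
  infer_instance

instance : DecidableRel F2G.Adj := by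
  unfold F2G
  infer_instance

lemma containsInduced_compC4star {a b c d e : V}
    (hac : R.Adj a c) (hbd : R.Adj b d)
    (hea : R.Adj e a) (heb : R.Adj e b) (hec : R.Adj e c) (hed : R.Adj e d)
    (hab : ¬ R.Adj a b) (had : ¬ R.Adj a d) (hbc : ¬ R.Adj b c) (hcd : ¬ R.Adj c d) :
    ContainsInduced R compC4star := by
  refine containsInduced_of_twinFree ![a, b, c, d, e] ?_ ?_
  · simp only [compC4star, SimpleGraph.fromRel_adj]
    decide
  · intro i j hij
    fin_cases i <;> fin_cases j <;>
      first
      | exact absurd hij (by decide)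
      | simp_all [compC4star, R.adj_comm]

/-- The long claw with centre `c` and legs `a₁a₂`, `b₁b₂`, `d₁d₂`. -/
lemma containsInduced_F1G {c a₁ a₂ b₁ b₂ d₁ d₂ : V}
    (ha₁ : R.Adj c a₁) (ha₂ : R.Adj a₁ a₂) (hb₁ : R.Adj c b₁) (hb₂ : R.Adj b₁ b₂)
    (hd₁ : R.Adj c d₁) (hd₂ : R.Adj d₁ d₂)
    (n₁ : ¬ R.Adj c a₂) (n₂ : ¬ R.Adj c b₂) (n₃ : ¬ R.Adj c d₂)
    (n₄ : ¬ R.Adj a₁ b₁) (n₅ : ¬ R.Adj a₁ b₂) (n₆ : ¬ R.Adj a₁ d₁) (n₇ : ¬ R.Adj a₁ d₂)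
    (n₈ : ¬ R.Adj a₂ b₁) (n₉ : ¬ R.Adj a₂ b₂) (m₁ : ¬ R.Adj a₂ d₁) (m₂ : ¬ R.Adj a₂ d₂)
    (m₃ : ¬ R.Adj b₁ d₁) (m₄ : ¬ R.Adj b₁ d₂) (m₅ : ¬ R.Adj b₂ d₁) (m₆ : ¬ R.Adj b₂ d₂) :
    ContainsInduced R F1G := by
  refine containsInduced_of_twinFree ![c, a₁, a₂, b₁, b₂, d₁, d₂] ?_ ?_
  · decide
  · intro i j hij
    fin_cases i <;> fin_cases j <;>
      first
      | exact absurd hij (by decide)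
      | simp_all [F1G]

/-- The 4-cycle `a b c d` with pendant vertices `a'`, `c'`, `d'` at `a`, `c`, `d`. -/
lemma containsInduced_F2G {a b c d a' c' d' : V}
    (hab : R.Adj a b) (hbc : R.Adj b c) (hcd : R.Adj c d) (had : R.Adj a d)
    (ha : R.Adj a a') (hc : R.Adj c c') (hd : R.Adj d d')
    (n₁ : ¬ R.Adj a c) (n₂ : ¬ R.Adj b d)
    (n₃ : ¬ R.Adj b a') (n₄ : ¬ R.Adj c a') (n₅ : ¬ R.Adj d a')
    (n₆ : ¬ R.Adj a c') (n₇ : ¬ R.Adj b c') (n₈ : ¬ R.Adj d c')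
    (n₉ : ¬ R.Adj a d') (m₁ : ¬ R.Adj b d') (m₂ : ¬ R.Adj c d')
    (m₃ : ¬ R.Adj a' c') (m₄ : ¬ R.Adj a' d') (m₅ : ¬ R.Adj c' d') :
    ContainsInduced R F2G := by
  refine containsInduced_of_twinFree ![a, b, c, d, a', c', d'] ?_ ?_
  · decide
  · intro i j hij
    fin_cases i <;> fin_cases j <;>
      first
      | exact absurd hij (by decide)
      | simp_all [F2G]

lemma hasCycleStar_three {a b c v : V} (hab : R.Adj a b) (hbc : R.Adj b c) (hac : R.Adj a c)
    (ha : ¬ R.Adj v a) (hb : ¬ R.Adj v b) (hc : ¬ R.Adj v c) : HasCycleStar R 3 := by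
  have key : ∀ i j : Fin 3,
      R.Adj (![a, b, c] i) (![a, b, c] j) ↔ (i = j + 1 ∨ j = i + 1) := by
    intro i j
    fin_cases i <;> fin_cases j <;> simp [R.adj_comm, *]
  refine ⟨(![a, b, c] : Fin 3 → V), v, ⟨le_rfl, ?_, key⟩, ?_⟩
  · intro i j hij
    have : ∀ i j : Fin 3, i ≠ j → (i = j + 1 ∨ j = i + 1) := by decide
    by_contra hne
    have := (key i j).2 (this i j hne)
    rw [show (![a, b, c] : Fin 3 → V) i = ![a, b, c] j from hij] at this
    exact R.irrefl this
  · intro i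
    change Fin 3 at i
    fin_cases i <;> assumption

lemma hasCycleStar_five {a b c d e v : V} (hab : R.Adj a b) (hbc : R.Adj b c) (hcd : R.Adj c d)
    (hde : R.Adj d e) (hae : R.Adj a e)
    (nac : ¬ R.Adj a c) (nad : ¬ R.Adj a d) (nbd : ¬ R.Adj b d) (nbe : ¬ R.Adj b e)
    (nce : ¬ R.Adj c e) (ha : ¬ R.Adj v a) (hb : ¬ R.Adj v b) (hc : ¬ R.Adj v c)
    (hd : ¬ R.Adj v d) (he : ¬ R.Adj v e) : HasCycleStar R 5 := by
  have key : ∀ i j : Fin 5,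
      R.Adj (![a, b, c, d, e] i) (![a, b, c, d, e] j) ↔ (i = j + 1 ∨ j = i + 1) := by
    intro i j
    fin_cases i <;> fin_cases j <;> simp_all [R.adj_comm]
  refine ⟨(![a, b, c, d, e] : Fin 5 → V), v, ⟨by norm_num, ?_, key⟩, ?_⟩
  · intro i j hij
    have twin : ∀ i j : Fin 5, (∀ k : Fin 5, (i = k + 1 ∨ k = i + 1) ↔ (j = k + 1 ∨ k = j + 1)) →
        i = j := by decide
    refine twin i j fun k => (key i k).symm.trans (Iff.trans ?_ (key j k))
    rw [show (![a, b, c, d, e] : Fin 5 → V) i = ![a, b, c, d, e] j from hij]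
  · intro i
    change Fin 5 at i
    fin_cases i <;> assumption

/-- `f` runs periodically around an induced even cycle of length `ℓ ≥ 8`. -/
structure IsEvenHole (R : SimpleGraph V) (ℓ : ℤ) (f : ℤ → V) : Prop where
  eight_le : 8 ≤ ℓ
  even : Even ℓ
  periodic : ∀ i, f (i + ℓ) = f i
  adj : ∀ i j, i < j → j < i + ℓ → (R.Adj (f i) (f j) ↔ j = i + 1 ∨ j = i + ℓ - 1)

namespace IsEvenHole

variable {ℓ : ℤ} {f : ℤ → V}

lemma shift (h : IsEvenHole R ℓ f) (c : ℤ) : IsEvenHole R ℓ (fun i => f (c + i)) where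
  eight_le := h.eight_le
  even := h.even
  periodic i := by rw [← add_assoc, h.periodic]
  adj i j hij hj := by
    rw [h.adj _ _ (by lia) (by lia)]
    constructor <;> intro <;> lia

lemma reflect (h : IsEvenHole R ℓ f) : IsEvenHole R ℓ (fun i => f (-i)) where
  eight_le := h.eight_le
  even := h.even
  periodic i := by rw [← h.periodic]; congr 1; ring
  adj i j hij hj := by
    rw [R.adj_comm, h.adj _ _ (by lia) (by lia)]
    constructor <;> intro <;> lia

lemma adj_succ (h : IsEvenHole R ℓ f) (i : ℤ) : R.Adj (f i) (f (i + 1)) := by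
  have := h.eight_le
  exact (h.adj _ _ (by lia) (by lia)).2 (Or.inl rfl)

/-- No vertex sees two consecutive vertices of the hole. -/
lemma not_adj_consecutive (h : IsEvenHole R ℓ f) (h₃ : ¬ HasCycleStar R 3)
    (hc : ¬ ContainsInduced R compC4star) {v : V} {i : ℤ} (hi : R.Adj v (f i)) :
    ¬ R.Adj v (f (i + 1)) := by
  intro hi'
  have h8 := h.eight_le
  have dom : ∀ k, k = i + 3 ∨ k = i + 4 → R.Adj v (f k) := by
    intro k hk
    by_contra hv
    refine h₃ (hasCycleStar_three (v := f k) hi (h.adj_succ i) hi' (fun h => hv h.symm) ?_ ?_) <;>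
    · rw [R.adj_comm, h.adj _ _ (by lia) (by lia)]
      lia
  refine hc (containsInduced_compC4star (a := f i) (c := f (i + 1)) (b := f (i + 3))
    (d := f (i + 4)) (e := v) (h.adj_succ i) ?_ hi (dom _ (by lia)) hi' (dom _ (by lia))
    ?_ ?_ ?_ ?_)
  · rw [h.adj _ _ (by lia) (by lia)]
    lia
  · rw [h.adj _ _ (by lia) (by lia)]
    lia
  · rw [h.adj _ _ (by lia) (by lia)]
    lia
  · rw [R.adj_comm, h.adj _ _ (by lia) (by lia)]
    lia
  · rw [h.adj _ _ (by lia) (by lia)]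
    lia

/-- All neighbours of a vertex on the hole have the same parity. -/
lemma even_sub_of_adj (h : IsEvenHole R ℓ f) (h₃ : ¬ HasCycleStar R 3)
    (h₅ : ¬ HasCycleStar R 5) (hc : ¬ ContainsInduced R compC4star)
    (h₁ : ¬ ContainsInduced R F1G) (h₂ : ¬ ContainsInduced R F2G) {v : V} {i j : ℤ}
    (hi : R.Adj v (f i)) (hj : R.Adj v (f j)) : Even (i - j) := by
  have h8 := h.eight_le
  obtain ⟨m, hm⟩ := h.even
  suffices main : ∀ (k : ℕ) (i : ℤ), R.Adj v (f i) → R.Adj v (f (i + k)) → ¬ Odd k by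
    rcases le_total i j with hij | hij
    · have := main (j - i).toNat i hi (by rwa [show i + ((j - i).toNat : ℤ) = j by lia])
      rw [Int.even_iff]
      rw [Nat.odd_iff] at this
      lia
    · have := main (i - j).toNat j hj (by rwa [show j + ((i - j).toNat : ℤ) = i by lia])
      rw [Int.even_iff]
      rw [Nat.odd_iff] at this
      lia
  intro k
  induction k using Nat.strong_induction_on with
  | _ k ih =>
  intro i hi hk hodd
  rw [Nat.odd_iff] at hodd
  have gap : ∀ n, i < n → n < i + k → ¬ R.Adj v (f n) := by
    intro n hn hn' hv
    rcases Nat.even_or_odd (n - i).toNat with hp | hp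
    · rw [Nat.even_iff] at hp
      refine ih (i + k - n).toNat (by lia) n hv ?_ (by rw [Nat.odd_iff]; lia)
      rwa [show n + ((i + k - n).toNat : ℤ) = i + k by lia]
    · refine ih (n - i).toNat (by lia) i hi ?_ hp
      rwa [show i + ((n - i).toNat : ℤ) = n by lia]
  have hlong : i + 2 * k ≤ i + ℓ := by
    by_contra hlt
    by_cases hkl : (k : ℤ) ≤ ℓ
    · refine ih (ℓ - k).toNat (by lia) (i + k) hk ?_ (by rw [Nat.odd_iff]; lia)
      rwa [show i + (k : ℤ) + ((ℓ - k).toNat : ℤ) = i + ℓ by lia, h.periodic]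
    · exact gap (i + ℓ) (by lia) (by lia) (by rwa [h.periodic])
  have k1 : k ≠ 1 := by
    rintro rfl
    exact h.not_adj_consecutive h₃ hc hi (by simpa using hk)
  by_cases k3 : k = 3
  · subst k3
    obtain ⟨n, hn, hvn⟩ : ∃ n, (n = i + 5 ∨ n = i + 6) ∧ ¬ R.Adj v (f n) := by
      by_cases h5 : R.Adj v (f (i + 5))
      · refine ⟨i + 6, by lia, ?_⟩
        have := h.not_adj_consecutive h₃ hc h5
        rwa [show i + 5 + 1 = i + 6 by ring] at this
      · exact ⟨i + 5, by lia, h5⟩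
    refine h₅ (hasCycleStar_five (a := v) (b := f i) (c := f (i + 1)) (d := f (i + 2))
      (e := f (i + 3)) (v := f n) hi (h.adj_succ i) ?_ ?_ (by simpa using hk)
      (gap _ (by lia) (by lia)) (gap _ (by lia) (by lia)) ?_ ?_ ?_ (fun h => hvn h.symm)
      ?_ ?_ ?_ ?_)
    iterate 5
      rw [h.adj _ _ (by lia) (by lia)]
      lia
    all_goals
      rw [R.adj_comm, h.adj _ _ (by lia) (by lia)]
      lia
  have k5 : 5 ≤ k := by lia
  have nk : ¬ R.Adj v (f (i + k + 1)) := h.not_adj_consecutive h₃ hc hk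
  by_cases hk2 : R.Adj v (f (i + k + 2))
  · refine h₂ (containsInduced_F2G (a := f (i + k)) (b := f (i + k + 1)) (c := f (i + k + 2))
      (d := v) (a' := f (i + k - 1)) (c' := f (i + k + 3)) (d' := f i)
      ?_ ?_ hk2.symm hk.symm ?_ ?_ hi ?_ (fun h => nk h.symm) ?_ ?_
      (gap _ (by lia) (by lia)) ?_ ?_ ?_ ?_ ?_ ?_ ?_ ?_ ?_)
    all_goals
      first
      | (rw [h.adj _ _ (by lia) (by lia)]
         lia)
      | (rw [R.adj_comm, h.adj _ _ (by lia) (by lia)]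
         lia)
      | skip
    have := h.not_adj_consecutive h₃ hc hk2
    rwa [show i + (k : ℤ) + 2 + 1 = i + k + 3 by ring] at this
  · refine h₁ (containsInduced_F1G (c := f (i + k)) (a₁ := f (i + k - 1)) (a₂ := f (i + k - 2))
      (b₁ := f (i + k + 1)) (b₂ := f (i + k + 2)) (d₁ := v) (d₂ := f i)
      ?_ ?_ ?_ ?_ hk.symm hi ?_ ?_ ?_ ?_ ?_ (fun h => gap _ (by lia) (by lia) h.symm) ?_ ?_ ?_
      (fun h => gap _ (by lia) (by lia) h.symm) ?_ (fun h => nk h.symm) ?_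
      (fun h => hk2 h.symm) ?_)
    all_goals
      first
      | (rw [h.adj _ _ (by lia) (by lia)]
         lia)
      | (rw [R.adj_comm, h.adj _ _ (by lia) (by lia)]
         lia)

/-- If `x` sees the hole at `i`, then so does every neighbour of `x`, close to `i`. -/
lemma exists_adj_near (h : IsEvenHole R ℓ f) (h₃ : ¬ HasCycleStar R 3)
    (h₅ : ¬ HasCycleStar R 5) (hc : ¬ ContainsInduced R compC4star)
    (h₁ : ¬ ContainsInduced R F1G) (h₂ : ¬ ContainsInduced R F2G) {x z : V} {i : ℤ}
    (hx : R.Adj x (f i)) (hxz : R.Adj x z) :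
    ∃ j, i - 3 ≤ j ∧ j ≤ i + 3 ∧ R.Adj z (f j) := by
  by_contra! hz
  have h8 := h.eight_le
  have odd : ∀ j, (j - i) % 2 = 1 → ¬ R.Adj x (f j) := by
    intro j hj hv
    have := h.even_sub_of_adj h₃ h₅ hc h₁ h₂ hv hx
    rw [Int.even_iff] at this
    lia
  have square : ∀ k, (k = i ∨ k = i - 2) → R.Adj x (f k) → ¬ R.Adj x (f (k + 2)) := by
    intro k hk hxk hxk'
    refine h₂ (containsInduced_F2G (a := f k) (b := f (k + 1)) (c := f (k + 2))
      (d := x) (a' := f (k - 1)) (c' := f (k + 3)) (d' := z)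
      ?_ ?_ hxk'.symm hxk.symm ?_ ?_ hxz ?_ (fun h => odd _ (by lia) h.symm) ?_ ?_
      (odd _ (by lia)) ?_ ?_ (odd _ (by lia)) (fun h => hz _ (by lia) (by lia) h.symm)
      (fun h => hz _ (by lia) (by lia) h.symm) (fun h => hz _ (by lia) (by lia) h.symm)
      ?_ (fun h => hz _ (by lia) (by lia) h.symm) (fun h => hz _ (by lia) (by lia) h.symm))
    all_goals
      first
      | (rw [h.adj _ _ (by lia) (by lia)]
         lia)
      | (rw [R.adj_comm, h.adj _ _ (by lia) (by lia)]
         lia)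
  have n₁ : ¬ R.Adj x (f (i + 2)) := square i (Or.inl rfl) hx
  have n₂ : ¬ R.Adj x (f (i - 2)) := by
    intro hx'
    refine square (i - 2) (Or.inr rfl) hx' ?_
    rwa [show i - 2 + 2 = i by ring]
  refine h₁ (containsInduced_F1G (c := f i) (a₁ := f (i - 1)) (a₂ := f (i - 2))
    (b₁ := f (i + 1)) (b₂ := f (i + 2)) (d₁ := x) (d₂ := z)
    ?_ ?_ ?_ ?_ hx.symm hxz ?_ ?_ (fun h => hz _ (by lia) (by lia) h.symm) ?_ ?_
    (fun h => odd _ (by lia) h.symm) (fun h => hz _ (by lia) (by lia) h.symm) ?_ ?_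
    (fun h => n₂ h.symm) (fun h => hz _ (by lia) (by lia) h.symm)
    (fun h => odd _ (by lia) h.symm) (fun h => hz _ (by lia) (by lia) h.symm)
    (fun h => n₁ h.symm) (fun h => hz _ (by lia) (by lia) h.symm))
  all_goals
    first
    | (rw [h.adj _ _ (by lia) (by lia)]
       lia)
    | (rw [R.adj_comm, h.adj _ _ (by lia) (by lia)]
       lia)

/-- Adjacent vertices see the hole in indices of different parity. -/
lemma odd_sub_of_adj (h : IsEvenHole R ℓ f) (h₃ : ¬ HasCycleStar R 3)
    (h₅ : ¬ HasCycleStar R 5) (hc : ¬ ContainsInduced R compC4star)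
    (h₁ : ¬ ContainsInduced R F1G) (h₂ : ¬ ContainsInduced R F2G) {x y : V} {i j : ℤ}
    (hxy : R.Adj x y) (hx : R.Adj x (f i)) (hy : R.Adj y (f j)) : Odd (i - j) := by
  rw [← Int.not_even_iff_odd]
  intro hev
  rw [Int.even_iff] at hev
  have h8 := h.eight_le
  have oddx : ∀ n, (n - i) % 2 = 1 → ¬ R.Adj x (f n) := by
    intro n hn hv
    have := h.even_sub_of_adj h₃ h₅ hc h₁ h₂ hv hx
    rw [Int.even_iff] at this
    lia
  have oddy : ∀ n, (n - i) % 2 = 1 → ¬ R.Adj y (f n) := by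
    intro n hn hv
    have := h.even_sub_of_adj h₃ h₅ hc h₁ h₂ hv hy
    rw [Int.even_iff] at this
    lia
  have common : ∀ n, (n - i) % 2 = 0 → R.Adj x (f n) → ¬ R.Adj y (f n) := by
    intro n hn hxn hyn
    refine h₃ (hasCycleStar_three (v := f (n + 3)) hxy hyn hxn
      (fun h => oddx _ (by lia) h.symm) (fun h => oddy _ (by lia) h.symm) ?_)
    rw [R.adj_comm, h.adj _ _ (by lia) (by lia)]
    lia
  have pentagon : ∀ u w, R.Adj u w → (∀ n, (n - i) % 2 = 1 → ¬ R.Adj u (f n)) →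
      (∀ n, (n - i) % 2 = 1 → ¬ R.Adj w (f n)) →
      (∀ n, (n - i) % 2 = 0 → R.Adj u (f n) → ¬ R.Adj w (f n)) →
      ∀ n, (n - i) % 2 = 0 → R.Adj u (f n) → ¬ R.Adj w (f (n + 2)) := by
    intro u w huw hu hw hc n hn hun hwn
    refine h₅ (hasCycleStar_five (a := u) (b := f n) (c := f (n + 1)) (d := f (n + 2))
      (e := w) (v := f (n + 5)) hun (h.adj_succ n) ?_ hwn.symm huw
      (hu _ (by lia)) (fun h => hc _ (by lia) h hwn) ?_ (fun h => hc _ hn hun h.symm)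
      (fun h => hw _ (by lia) h.symm) (fun h => hu _ (by lia) h.symm) ?_ ?_ ?_
      (fun h => hw _ (by lia) h.symm))
    all_goals
      first
      | (rw [h.adj _ _ (by lia) (by lia)]
         lia)
      | (rw [R.adj_comm, h.adj _ _ (by lia) (by lia)]
         lia)
  obtain ⟨k, hk, hk', hyk⟩ := h.exists_adj_near h₃ h₅ hc h₁ h₂ hx hxy
  have hpar : (k - i) % 2 = 0 := by
    by_contra hne
    exact oddy k (by lia) hyk
  obtain rfl | rfl | hik : k = i ∨ k = i + 2 ∨ i = k + 2 := by lia
  · exact common k hpar hx hyk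
  · exact pentagon x y hxy oddx oddy common i (by lia) hx hyk
  · subst hik
    exact pentagon y x hxy.symm oddy oddx (fun n hn h h' => common n hn h' h) k hpar hyk hx

/-- The neighbours on the hole determine a proper 2-colouring of the graph. -/
theorem isBipartite (h : IsEvenHole R ℓ f) (hconn : R.Connected) (h₃ : ¬ HasCycleStar R 3)
    (h₅ : ¬ HasCycleStar R 5) (hc : ¬ ContainsInduced R compC4star)
    (h₁ : ¬ ContainsInduced R F1G) (h₂ : ¬ ContainsInduced R F2G) : IsBipartite R := by
  have dom : ∀ v, ∃ i, R.Adj v (f i) := by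
    intro v
    obtain ⟨p⟩ := hconn.preconnected v (f 0)
    generalize hw : f 0 = w at p
    induction p with
    | nil => exact ⟨1, hw ▸ h.adj_succ 0⟩
    | cons huv _ ih =>
      obtain ⟨i, hi⟩ := ih hw
      obtain ⟨j, -, -, hj⟩ := h.exists_adj_near h₃ h₅ hc h₁ h₂ hi huv.symm
      exact ⟨j, hj⟩
  choose i hi using dom
  refine ⟨fun v => decide (Even (i v)), fun u v huv heq => ?_⟩
  have := h.odd_sub_of_adj h₃ h₅ hc h₁ h₂ huv (hi u) (hi v)
  rw [← Int.not_even_iff_odd, Int.even_sub] at this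
  exact this (by simpa using heq)

end IsEvenHole

/-- An even induced cycle, parametrised periodically by the integers. -/
lemma IsInducedCycle.isEvenHole {ℓ : ℕ} {g : ZMod ℓ → V} (hg : IsInducedCycle R ℓ g)
    (h8 : 8 ≤ ℓ) (heven : Even ℓ) : IsEvenHole R ℓ (fun i : ℤ => g i) where
  eight_le := by exact_mod_cast h8
  even := by exact_mod_cast heven
  periodic i := by simp
  adj i j hij hj := by
    have e₁ : ((i : ZMod ℓ) = j + 1) ↔ (ℓ : ℤ) ∣ j + 1 - i := by
      rw [← ZMod.intCast_eq_intCast_iff_dvd_sub]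
      push_cast
      rfl
    have e₂ : ((j : ZMod ℓ) = i + 1) ↔ (ℓ : ℤ) ∣ i + 1 - j := by
      rw [← ZMod.intCast_eq_intCast_iff_dvd_sub]
      push_cast
      rfl
    rw [hg.2.2, e₁, e₂]
    constructor
    · rintro (⟨c, hc⟩ | ⟨c, hc⟩)
      · have hc1 : c = 1 := by
          have : 0 < c := by nlinarith
          have : c < 2 := by nlinarith
          lia
        subst hc1
        lia
      · have hc0 : c = 0 := by
          have : -1 < c := by nlinarith
          have : c < 1 := by nlinarith
          lia
        subst hc0
        lia
    · rintro (rfl | rfl)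
      · exact Or.inr (by simp)
      · exact Or.inl ⟨1, by ring⟩

/-- A bipartite graph has no odd cycle. -/
lemma IsBipartite.not_isInducedCycle_of_odd (hR : IsBipartite R) {ℓ : ℕ} (hodd : Odd ℓ)
    (g : ZMod ℓ → V) : ¬ IsInducedCycle R ℓ g := by
  intro hg
  obtain ⟨c, hc⟩ := hR
  have step : ∀ n : ℕ, c (g n) = (c (g 0) ^^ decide (Odd n)) := by
    intro n
    induction n with
    | zero => simp
    | succ n ih =>
      have := hc _ _ ((hg.2.2 (n : ZMod ℓ) (n + 1)).2 (Or.inr rfl))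
      rw [ih] at this
      push_cast
      simp only [Nat.odd_add_one]
      revert this
      generalize c (g (n + 1)) = p
      generalize c (g 0) = q
      by_cases hn : Odd n <;> cases p <;> cases q <;> simp [hn]
  have := step ℓ
  simp [hodd] at this

end EvenHole

/-- If `B` is an induced cycle of even length at least 8 in a
reduced graph `R`, then no odd induced cycle of `R` has a vertex in common
with `B`. -/
theorem reduced_no_odd_cycle_meets_even_hole {V : Type*} [Fintype V] (R : SimpleGraph V)
    (hR : IsReducedGraph R) (ℓ : ℕ) (fB : ZMod ℓ → V)
    (h8 : 8 ≤ ℓ) (heven : Even ℓ) (hB : IsInducedCycle R ℓ fB) :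
    ∀ (ℓC : ℕ) (fC : ZMod ℓC → V), Odd ℓC → IsInducedCycle R ℓC fC →
      Set.range fC ∩ Set.range fB = ∅ := by
  intro ℓC fC hodd hC
  obtain ⟨hconn, -, h₃, h₅, hc, -, -, -, h₁, h₂, -, -⟩ := hR
  have hbip := (hB.isEvenHole h8 heven).isBipartite hconn h₃ h₅ hc h₁ h₂
  exact absurd hC (hbip.not_isInducedCycle_of_odd hodd fC)
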